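/- The 4-dimensional superalgebra A = K[x]/(x⁴) with grading A₀ = span{1, x²} and A₁ = span{x, x³} admits no superbialgebra structure: there exist no grading-preserving K-linear maps Δ : A → A ⊗ A and ε : A → K making this superalgebra into a superbialgebra. -/

import Mathlib

open TensorProduct

section SuperDefs

variable (K A : Type*) [Field K] [Ring A] [Algebra K A]

/-- A superalgebra structure on the unital associative `K`-algebra `A`: a `ℤ/2ℤ`-grading
`A = A₀ ⊕ A₁` of `K`-vector spaces with `1 ∈ A₀` and `Aᵢ · Aⱼ ⊆ A_{i+j mod 2}`. -/
structure SuperAlgebra where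
  A₀ : Submodule K A
  A₁ : Submodule K A
  compl : IsCompl A₀ A₁
  one_mem : (1 : A) ∈ A₀
  mul_mem₀₀ : ∀ a ∈ A₀, ∀ b ∈ A₀, a * b ∈ A₀
  mul_mem₀₁ : ∀ a ∈ A₀, ∀ b ∈ A₁, a * b ∈ A₁
  mul_mem₁₀ : ∀ a ∈ A₁, ∀ b ∈ A₀, a * b ∈ A₁
  mul_mem₁₁ : ∀ a ∈ A₁, ∀ b ∈ A₁, a * b ∈ A₀

namespace SuperAlgebra

variable {K A}

/-- The projection onto the even part along the odd part. -/
noncomputable def p₀ (S : SuperAlgebra K A) : A →ₗ[K] A :=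
  S.A₀.subtype ∘ₗ Submodule.linearProjOfIsCompl S.A₀ S.A₁ S.compl

/-- The projection onto the odd part along the even part. -/
noncomputable def p₁ (S : SuperAlgebra K A) : A →ₗ[K] A :=
  S.A₁.subtype ∘ₗ Submodule.linearProjOfIsCompl S.A₁ S.A₀ S.compl.symm

/-- The superflip `τ : A ⊗ A → A ⊗ A`, `a ⊗ b ↦ (-1)^{|a||b|} b ⊗ a` on homogeneous
elements. -/
noncomputable def τ (S : SuperAlgebra K A) : A ⊗[K] A →ₗ[K] A ⊗[K] A :=
  (TensorProduct.comm K A A).toLinearMap ∘ₗ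
    (TensorProduct.map S.p₀ S.p₀ + TensorProduct.map S.p₀ S.p₁ +
      TensorProduct.map S.p₁ S.p₀ - TensorProduct.map S.p₁ S.p₁)

variable (K A) in
/-- Regrouping `(A ⊗ A) ⊗ (A ⊗ A) ≃ A ⊗ ((A ⊗ A) ⊗ A)`. -/
noncomputable def rearr : ((A ⊗[K] A) ⊗[K] (A ⊗[K] A)) ≃ₗ[K] (A ⊗[K] ((A ⊗[K] A) ⊗[K] A)) :=
  (TensorProduct.assoc K A A (A ⊗[K] A)) ≪≫ₗ
    TensorProduct.congr (LinearEquiv.refl K A) (TensorProduct.assoc K A A A).symm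

/-- The map `(μ ⊗ μ) ∘ (id ⊗ τ ⊗ id) : (A ⊗ A) ⊗ (A ⊗ A) → A ⊗ A`, i.e. the super
multiplication of `A ⊗ A`. -/
noncomputable def superBimul (S : SuperAlgebra K A) :
    ((A ⊗[K] A) ⊗[K] (A ⊗[K] A)) →ₗ[K] A ⊗[K] A :=
  TensorProduct.map (LinearMap.mul' K A) (LinearMap.mul' K A) ∘ₗ
    (rearr K A).symm.toLinearMap ∘ₗ
    TensorProduct.map (LinearMap.id : A →ₗ[K] A)
      (TensorProduct.map S.τ (LinearMap.id : A →ₗ[K] A)) ∘ₗ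
    (rearr K A).toLinearMap

/-- The even part of `A ⊗ A` for the total grading. -/
def evenTensor (S : SuperAlgebra K A) : Submodule K (A ⊗[K] A) :=
  LinearMap.range (TensorProduct.map S.A₀.subtype S.A₀.subtype) ⊔
    LinearMap.range (TensorProduct.map S.A₁.subtype S.A₁.subtype)

/-- The odd part of `A ⊗ A` for the total grading. -/
def oddTensor (S : SuperAlgebra K A) : Submodule K (A ⊗[K] A) :=
  LinearMap.range (TensorProduct.map S.A₀.subtype S.A₁.subtype) ⊔
    LinearMap.range (TensorProduct.map S.A₁.subtype S.A₀.subtype)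

end SuperAlgebra

/-- A superbialgebra over `K`: a superalgebra together with grading-preserving linear maps
`Δ : A → A ⊗ A` and `ε : A → K` satisfying coassociativity, counity, and compatibility
with the (super)algebra structure. -/
structure SuperBialgebra extends SuperAlgebra K A where
  Δ : A →ₗ[K] A ⊗[K] A
  ε : A →ₗ[K] K
  Δ_even : ∀ a ∈ A₀, Δ a ∈ toSuperAlgebra.evenTensor
  Δ_odd : ∀ a ∈ A₁, Δ a ∈ toSuperAlgebra.oddTensor
  ε_odd : ∀ a ∈ A₁, ε a = 0
  coassoc : ∀ a : A,
    TensorProduct.assoc K A A A (TensorProduct.map Δ (LinearMap.id : A →ₗ[K] A) (Δ a)) =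
      TensorProduct.map (LinearMap.id : A →ₗ[K] A) Δ (Δ a)
  counit_left : ∀ a : A,
    TensorProduct.lid K A (TensorProduct.map ε (LinearMap.id : A →ₗ[K] A) (Δ a)) = a
  counit_right : ∀ a : A,
    TensorProduct.rid K A (TensorProduct.map (LinearMap.id : A →ₗ[K] A) ε (Δ a)) = a
  Δ_one : Δ 1 = 1 ⊗ₜ[K] 1
  ε_one : ε 1 = 1
  ε_mul : ∀ a b : A, ε (a * b) = ε a * ε b
  Δ_mul : ∀ a b : A, Δ (a * b) = toSuperAlgebra.superBimul (Δ a ⊗ₜ[K] Δ b)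

/-- A Hopf superalgebra: a superbialgebra with a grading-preserving antipode `S`
satisfying `μ ∘ (S ⊗ id) ∘ Δ = μ ∘ (id ⊗ S) ∘ Δ = η ∘ ε`. -/
structure HopfSuperalgebra extends SuperBialgebra K A where
  antipode : A →ₗ[K] A
  antipode_even : ∀ a ∈ A₀, antipode a ∈ A₀
  antipode_odd : ∀ a ∈ A₁, antipode a ∈ A₁
  antipode_left : ∀ a : A,
    LinearMap.mul' K A (TensorProduct.map antipode (LinearMap.id : A →ₗ[K] A) (Δ a)) =
      algebraMap K A (ε a)
  antipode_right : ∀ a : A,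
    LinearMap.mul' K A (TensorProduct.map (LinearMap.id : A →ₗ[K] A) antipode (Δ a)) =
      algebraMap K A (ε a)

end SuperDefs


section Helpers

variable {K A : Type*} [Field K] [Ring A] [Algebra K A]

theorem helper_p0_even (S : SuperAlgebra K A) {a : A} (h : a ∈ S.A₀) : S.p₀ a = a := by
  exact congrArg Subtype.val
    (Submodule.linearProjOfIsCompl_apply_left S.compl ⟨a, h⟩)

theorem helper_p1_even (S : SuperAlgebra K A) {a : A} (h : a ∈ S.A₀) : S.p₁ a = 0 := by
  exact congrArg Subtype.val
    (Submodule.linearProjOfIsCompl_apply_right S.compl.symm ⟨a, h⟩)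

theorem helper_p0_odd (S : SuperAlgebra K A) {a : A} (h : a ∈ S.A₁) : S.p₀ a = 0 := by
  exact congrArg Subtype.val
    (Submodule.linearProjOfIsCompl_apply_right S.compl ⟨a, h⟩)

theorem helper_p1_odd (S : SuperAlgebra K A) {a : A} (h : a ∈ S.A₁) : S.p₁ a = a := by
  exact congrArg Subtype.val
    (Submodule.linearProjOfIsCompl_apply_left S.compl.symm ⟨a, h⟩)

theorem helper_bimul_sign (S : SuperAlgebra K A) {a b c d : A} (r : K)
    (h : S.τ (b ⊗ₜ[K] c) = r • (c ⊗ₜ[K] b)) :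
    S.superBimul ((a ⊗ₜ[K] b) ⊗ₜ[K] (c ⊗ₜ[K] d)) = r • ((a * c) ⊗ₜ[K] (b * d)) := by
  simp [SuperAlgebra.superBimul, SuperAlgebra.rearr, h, TensorProduct.smul_tmul']

theorem helper_tau00 (S : SuperAlgebra K A) {b c : A} (hb : b ∈ S.A₀) (hc : c ∈ S.A₀) :
    S.τ (b ⊗ₜ[K] c) = (1 : K) • (c ⊗ₜ[K] b) := by
  simp [SuperAlgebra.τ, helper_p0_even S hb, helper_p1_even S hb, helper_p0_even S hc,
    helper_p1_even S hc]

theorem helper_tau01 (S : SuperAlgebra K A) {b c : A} (hb : b ∈ S.A₀) (hc : c ∈ S.A₁) :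
    S.τ (b ⊗ₜ[K] c) = (1 : K) • (c ⊗ₜ[K] b) := by
  simp [SuperAlgebra.τ, helper_p0_even S hb, helper_p1_even S hb, helper_p0_odd S hc,
    helper_p1_odd S hc]

theorem helper_tau10 (S : SuperAlgebra K A) {b c : A} (hb : b ∈ S.A₁) (hc : c ∈ S.A₀) :
    S.τ (b ⊗ₜ[K] c) = (1 : K) • (c ⊗ₜ[K] b) := by
  simp [SuperAlgebra.τ, helper_p0_odd S hb, helper_p1_odd S hb, helper_p0_even S hc,
    helper_p1_even S hc]

theorem helper_tau11 (S : SuperAlgebra K A) {b c : A} (hb : b ∈ S.A₁) (hc : c ∈ S.A₁) :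
    S.τ (b ⊗ₜ[K] c) = (-1 : K) • (c ⊗ₜ[K] b) := by
  simp [SuperAlgebra.τ, helper_p0_odd S hb, helper_p1_odd S hb, helper_p0_odd S hc,
    helper_p1_odd S hc]

theorem helper_range (P Q : Submodule K A) (p q r s : A)
    (hP : P = Submodule.span K {p, q}) (hQ : Q = Submodule.span K {r, s}) (t : A ⊗[K] A)
    (ht : t ∈ LinearMap.range (TensorProduct.map P.subtype Q.subtype)) :
    ∃ a b c d : K, t = a • (p ⊗ₜ[K] r) + b • (p ⊗ₜ[K] s) + c • (q ⊗ₜ[K] r)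
      + d • (q ⊗ₜ[K] s) := by
  obtain ⟨u, rfl⟩ := ht
  induction u using TensorProduct.induction_on with
  | zero => exact ⟨0, 0, 0, 0, by simp⟩
  | tmul u v =>
    obtain ⟨u, hu⟩ := u
    obtain ⟨v, hv⟩ := v
    have hu' := hu
    have hv' := hv
    rw [hP, Submodule.mem_span_pair] at hu'
    rw [hQ, Submodule.mem_span_pair] at hv'
    obtain ⟨a, b, rfl⟩ := hu'
    obtain ⟨c, d, rfl⟩ := hv'
    refine ⟨a * c, a * d, b * c, b * d, ?_⟩
    simp only [TensorProduct.map_tmul, Submodule.subtype_apply, TensorProduct.add_tmul,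
      TensorProduct.tmul_add, TensorProduct.smul_tmul_smul]
    abel
  | add u v hu hv =>
    obtain ⟨a, b, c, d, h⟩ := hu
    obtain ⟨a', b', c', d', h'⟩ := hv
    refine ⟨a + a', b + b', c + c', d + d', ?_⟩
    rw [map_add, h, h']
    module

end Helpers

/-- the superalgebra `K[x]/(x⁴)` with even part `span{1, x²}` and odd
part `span{x, x³}` admits no superbialgebra structure. -/
theorem Kx_mod_x4_admits_no_superbialgebra
    {K A : Type*} [Field K] [IsAlgClosed K] [CharZero K] [Ring A] [Algebra K A]
    (B : SuperBialgebra K A) (x : A)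
    (hrel : x ^ 4 = 0)
    (hind : LinearIndependent K ![(1 : A), x, x ^ 2, x ^ 3])
    (h0 : B.A₀ = Submodule.span K {1, x ^ 2})
    (h1 : B.A₁ = Submodule.span K {x, x ^ 3}) :
    False := by
  have hx1 : x ∈ B.A₁ := by rw [h1]; exact Submodule.subset_span (by simp)
  have hx3 : x ^ 3 ∈ B.A₁ := by rw [h1]; exact Submodule.subset_span (by simp)
  have hx2 : x ^ 2 ∈ B.A₀ := by rw [h0]; exact Submodule.subset_span (by simp)
  have hx0 : (1 : A) ∈ B.A₀ := B.one_mem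
  have e1 : B.ε x = 0 := B.ε_odd x hx1
  have e3 : B.ε (x ^ 3) = 0 := B.ε_odd _ hx3
  have e2 : B.ε (x ^ 2) = 0 := by rw [pow_two, B.ε_mul, e1, zero_mul]
  have e0 := B.ε_one
  obtain ⟨t, ht, u, hu, htu⟩ := Submodule.mem_sup.mp (B.Δ_odd x hx1)
  obtain ⟨a1, a2, a, c, rfl⟩ := helper_range _ _ _ _ _ _ h0 h1 t ht
  obtain ⟨b1, b, b2, d, rfl⟩ := helper_range _ _ _ _ _ _ h1 h0 u hu
  have hind' := Fintype.linearIndependent_iff.mp hind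
  have cl := B.counit_left x
  have cr := B.counit_right x
  rw [← htu] at cl cr
  simp [e0, e1, e2, e3] at cl cr
  have kl := hind' ![0, a1 - 1, 0, a2] (by
    simp only [Fin.sum_univ_four]
    simp [sub_smul]
    rw [sub_add_eq_add_sub, cl, sub_self])
  have kr := hind' ![0, b1 - 1, 0, b2] (by
    simp only [Fin.sum_univ_four]
    simp [sub_smul]
    rw [sub_add_eq_add_sub, cr, sub_self])
  have ka1 : a1 = 1 := by simpa [sub_eq_zero] using kl 1
  have ka2 : a2 = 0 := by simpa using kl 3
  have kb1 : b1 = 1 := by simpa [sub_eq_zero] using kr 1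
  have kb2 : b2 = 0 := by simpa using kr 3
  subst ka1 ka2 kb1 kb2
  have m00 := fun (p q : A) {b c : A} hb hc =>
    helper_bimul_sign B.toSuperAlgebra (a := p) (d := q) 1
      (helper_tau00 B.toSuperAlgebra (b := b) (c := c) hb hc)
  have m01 := fun (p q : A) {b c : A} hb hc =>
    helper_bimul_sign B.toSuperAlgebra (a := p) (d := q) 1
      (helper_tau01 B.toSuperAlgebra (b := b) (c := c) hb hc)
  have m10 := fun (p q : A) {b c : A} hb hc =>
    helper_bimul_sign B.toSuperAlgebra (a := p) (d := q) 1
      (helper_tau10 B.toSuperAlgebra (b := b) (c := c) hb hc)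
  have m11 := fun (p q : A) {b c : A} hb hc =>
    helper_bimul_sign B.toSuperAlgebra (a := p) (d := q) (-1)
      (helper_tau11 B.toSuperAlgebra (b := b) (c := c) hb hc)
  have q11 : x * x = x ^ 2 := (pow_two x).symm
  have q12 : x * x ^ 2 = x ^ 3 := (pow_succ' x 2).symm
  have q21 : x ^ 2 * x = x ^ 3 := (pow_succ x 2).symm
  have q13 : x * x ^ 3 = 0 := by rw [← pow_succ', hrel]
  have q31 : x ^ 3 * x = 0 := by rw [← pow_succ, hrel]
  have q22 : x ^ 2 * x ^ 2 = 0 := by rw [← pow_add, hrel]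
  have q23 : x ^ 2 * x ^ 3 = 0 := by rw [← pow_add, pow_succ, hrel, zero_mul]
  have q32 : x ^ 3 * x ^ 2 = 0 := by rw [← pow_add, pow_succ, hrel, zero_mul]
  have q33 : x ^ 3 * x ^ 3 = 0 := by
    rw [← pow_add, show 3 + 3 = 4 + 2 from rfl, pow_add, hrel, zero_mul]
  have D2 : B.Δ (x ^ 2) = (x ^ 2) ⊗ₜ[K] 1 + 1 ⊗ₜ[K] (x ^ 2)
      + (2 * (a + b)) • ((x ^ 2) ⊗ₜ[K] (x ^ 2)) := by
    rw [← q11, B.Δ_mul, ← htu, q11]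
    simp only [TensorProduct.add_tmul, TensorProduct.tmul_add,
      map_add, map_smul, zero_smul, one_smul, add_zero, zero_add,
      TensorProduct.tmul_smul, ← TensorProduct.smul_tmul', TensorProduct.zero_tmul,
      TensorProduct.tmul_zero, smul_zero,
      m00 _ _ hx0 hx0, m00 _ _ hx0 hx2, m00 _ _ hx2 hx0, m00 _ _ hx2 hx2,
      m01 _ _ hx0 hx1, m01 _ _ hx0 hx3, m01 _ _ hx2 hx1, m01 _ _ hx2 hx3,
      m10 _ _ hx1 hx0, m10 _ _ hx1 hx2, m10 _ _ hx3 hx0, m10 _ _ hx3 hx2,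
      m11 _ _ hx1 hx1, m11 _ _ hx1 hx3, m11 _ _ hx3 hx1, m11 _ _ hx3 hx3,
      q11, q12, q21, q13, q31, q22, q23, q32, q33, mul_one, one_mul]
    module
  have D4 : B.Δ (x ^ 2 * x ^ 2) = (2 : K) • ((x ^ 2) ⊗ₜ[K] (x ^ 2)) := by
    rw [B.Δ_mul, D2]
    simp only [TensorProduct.add_tmul, TensorProduct.tmul_add,
      map_add, map_smul, zero_smul, one_smul, add_zero, zero_add,
      TensorProduct.tmul_smul, ← TensorProduct.smul_tmul', TensorProduct.zero_tmul,
      TensorProduct.tmul_zero, smul_zero,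
      m00 _ _ hx0 hx0, m00 _ _ hx0 hx2, m00 _ _ hx2 hx0, m00 _ _ hx2 hx2,
      q22, mul_one, one_mul]
    module
  rw [q22, map_zero] at D4
  have hne : x ^ 2 ≠ 0 := hind.ne_zero 2
  have h := (smul_eq_zero.mp D4.symm).resolve_left two_ne_zero
  apply hne
  rw [← Module.forall_dual_apply_eq_zero_iff K]
  intro f
  have h2 := congrArg (fun z => LinearMap.mul' K K (TensorProduct.map f f z)) h
  simpa using h2
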